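/- Let ρ be a definite 3-form on a 6-dimensional real vector space V, let v ∈ V be nonzero, and let v' be a nonzero element of the null space N_v. Then the bilinear form (x,y) ↦ ρ(v',x,y) vanishes whenever x ∈ N_v, and the induced alternating bilinear form on the 4-dimensional quotient space V/N_v is nondegenerate (a symplectic form). -/

import Mathlib

/-- The contraction `i_v ρ` of an alternating 3-form, viewed as the linear map
`x ↦ (z ↦ ρ (v, x, z))` from `V` to the space of 1-forms. -/
noncomputable def contraction3 {V : Type*} [AddCommGroup V] [Module ℝ V]
    (ρ : V [⋀^Fin 3]→ₗ[ℝ] ℝ) (v : V) : V →ₗ[ℝ] (V [⋀^Fin 1]→ₗ[ℝ] ℝ) :=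
  AlternatingMap.curryLeft (ρ.curryLeft v)

/-- A 3-form on a (6-dimensional) real vector space is *definite* if for every
nonzero `v` the contraction `i_v ρ` has rank 4. -/
def IsDefinite3Form {V : Type*} [AddCommGroup V] [Module ℝ V]
    (ρ : V [⋀^Fin 3]→ₗ[ℝ] ℝ) : Prop :=
  ∀ v : V, v ≠ 0 →
    Module.finrank ℝ (LinearMap.range (contraction3 ρ v)) = 4

/-- The null space `N_v = {w | ρ(v, w, z) = 0 for all z}` of the contraction `i_v ρ`. -/
noncomputable def nullSpace {V : Type*} [AddCommGroup V] [Module ℝ V]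
    (ρ : V [⋀^Fin 3]→ₗ[ℝ] ℝ) (v : V) : Submodule ℝ V :=
  LinearMap.ker (contraction3 ρ v)

open Module

section AlternatingThreeForm

variable {V : Type*} [AddCommGroup V] [Module ℝ V] (ρ : V [⋀^Fin 3]→ₗ[ℝ] ℝ)

theorem contraction3_apply_apply (v w z : V) :
    contraction3 ρ v w ![z] = ρ ![v, w, z] := rfl

theorem mem_nullSpace_iff {ρ : V [⋀^Fin 3]→ₗ[ℝ] ℝ} {v w : V} :
    w ∈ nullSpace ρ v ↔ ∀ z : V, ρ ![v, w, z] = 0 := by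
  refine ⟨fun h z ↦ ?_, fun h ↦ LinearMap.mem_ker.2 (AlternatingMap.ext fun z ↦ ?_)⟩
  · rw [← contraction3_apply_apply, LinearMap.mem_ker.1 h, AlternatingMap.zero_apply]
  · have hz : z = ![z 0] := List.ofFn_inj.1 rfl
    rw [hz, contraction3_apply_apply, h, AlternatingMap.zero_apply]

theorem self_mem_nullSpace (v : V) : v ∈ nullSpace ρ v :=
  mem_nullSpace_iff.2 fun z ↦
    ρ.map_eq_zero_of_eq ![v, v, z] (i := 0) (j := 1) rfl (by decide)

theorem mem_nullSpace_comm {ρ : V [⋀^Fin 3]→ₗ[ℝ] ℝ} {v w : V} :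
    w ∈ nullSpace ρ v ↔ v ∈ nullSpace ρ w := by
  have swap (a b z : V) : ρ ![b, a, z] = -ρ ![a, b, z] := by
    rw [← ρ.map_swap ![a, b, z] (i := 0) (j := 1) (by decide)]
    congr 1
    ext i
    fin_cases i <;> rfl
  simp only [mem_nullSpace_iff, swap v w, neg_eq_zero]

theorem finrank_range_contraction3_add_finrank_nullSpace [FiniteDimensional ℝ V] (v : V) :
    finrank ℝ (LinearMap.range (contraction3 ρ v)) + finrank ℝ (nullSpace ρ v) = finrank ℝ V :=
  LinearMap.finrank_range_add_finrank_ker _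

theorem IsDefinite3Form.finrank_nullSpace [FiniteDimensional ℝ V] (hdim : finrank ℝ V = 6)
    {ρ : V [⋀^Fin 3]→ₗ[ℝ] ℝ} (hρ : IsDefinite3Form ρ) {v : V} (hv : v ≠ 0) :
    finrank ℝ (nullSpace ρ v) = 2 := by
  have := finrank_range_contraction3_add_finrank_nullSpace ρ v
  rw [hρ v hv] at this
  omega

/-- The null space is constant along its nonzero elements. -/
theorem IsDefinite3Form.nullSpace_eq_of_mem [FiniteDimensional ℝ V] (hdim : finrank ℝ V = 6)
    {ρ : V [⋀^Fin 3]→ₗ[ℝ] ℝ} (hρ : IsDefinite3Form ρ) {v w : V} (hv : v ≠ 0)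
    (hw : w ∈ nullSpace ρ v) (hw0 : w ≠ 0) : nullSpace ρ v = nullSpace ρ w := by
  have hrank : finrank ℝ (nullSpace ρ v) = finrank ℝ (nullSpace ρ w) := by
    rw [hρ.finrank_nullSpace hdim hv, hρ.finrank_nullSpace hdim hw0]
  refine Submodule.eq_of_le_of_finrank_eq ?_ hrank
  by_cases hli : LinearIndependent ℝ ![v, w]
  · have hspan : Submodule.span ℝ (Set.range ![v, w]) = nullSpace ρ v := by
      refine Submodule.eq_of_le_of_finrank_eq (Submodule.span_le.2 ?_) ?_
      · rintro _ ⟨i, rfl⟩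
        fin_cases i
        exacts [self_mem_nullSpace ρ v, hw]
      · rw [finrank_span_eq_card hli, hρ.finrank_nullSpace hdim hv, Fintype.card_fin]
    rw [← hspan, Submodule.span_le]
    rintro _ ⟨i, rfl⟩
    fin_cases i
    exacts [mem_nullSpace_comm.1 hw, self_mem_nullSpace ρ w]
  · rw [LinearIndependent.pair_iff' hv] at hli
    push Not at hli
    obtain ⟨a, rfl⟩ := hli
    exact fun x hx ↦ mem_nullSpace_comm.1 (Submodule.smul_mem _ a (mem_nullSpace_comm.1 hx))

/-- The contraction `i_v ρ` as a bilinear form. -/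
noncomputable def contractionBilin (v : V) : LinearMap.BilinForm ℝ V :=
  LinearMap.mk₂ ℝ (fun x y ↦ ρ ![v, x, y])
    (fun x x' y ↦ by simp only [← contraction3_apply_apply, map_add, AlternatingMap.add_apply])
    (fun c x y ↦ by simp only [← contraction3_apply_apply, map_smul, AlternatingMap.smul_apply])
    (fun x y y' ↦ (contraction3 ρ v x).map_vecCons_add ![] y y')
    (fun c x y ↦ (contraction3 ρ v x).map_vecCons_smul ![] c y)

@[simp]
theorem contractionBilin_apply (v x y : V) : contractionBilin ρ v x y = ρ ![v, x, y] := rfl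

theorem isAlt_contractionBilin (v : V) : (contractionBilin ρ v).IsAlt := fun x ↦
  ρ.map_eq_zero_of_eq ![v, x, x] (i := 1) (j := 2) rfl (by decide)

theorem ker_contractionBilin (v : V) : LinearMap.ker (contractionBilin ρ v) = nullSpace ρ v := by
  ext w
  simp [mem_nullSpace_iff, LinearMap.ext_iff]

end AlternatingThreeForm

/-- for a definite 3-form `ρ`, nonzero `v`, and nonzero `v' ∈ N_v`,
the bilinear form `(x, y) ↦ ρ(v', x, y)` vanishes when `x ∈ N_v`, and it induces a
nondegenerate alternating bilinear (symplectic) form on the 4-dimensional quotient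
`V ⧸ N_v`. -/
theorem induced_form_on_quotient_symplectic
    {V : Type*} [AddCommGroup V] [Module ℝ V] [FiniteDimensional ℝ V]
    (hdim : Module.finrank ℝ V = 6)
    (ρ : V [⋀^Fin 3]→ₗ[ℝ] ℝ) (hρ : IsDefinite3Form ρ)
    (v : V) (hv : v ≠ 0)
    (v' : V) (hv' : v' ∈ nullSpace ρ v) (hv'0 : v' ≠ 0) :
    (∀ x ∈ nullSpace ρ v, ∀ y : V, ρ ![v', x, y] = 0) ∧
    Module.finrank ℝ (V ⧸ nullSpace ρ v) = 4 ∧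
    ∃ Ω : (V ⧸ nullSpace ρ v) →ₗ[ℝ] (V ⧸ nullSpace ρ v) →ₗ[ℝ] ℝ,
      (∀ x y : V, Ω (Submodule.Quotient.mk x) (Submodule.Quotient.mk y)
          = ρ ![v', x, y]) ∧
      (∀ u : V ⧸ nullSpace ρ v, Ω u u = 0) ∧
      ∀ u : V ⧸ nullSpace ρ v, (∀ w : V ⧸ nullSpace ρ v, Ω u w = 0) → u = 0 := by
  have heq : nullSpace ρ v = nullSpace ρ v' := hρ.nullSpace_eq_of_mem hdim hv hv' hv'0
  have hker : nullSpace ρ v = LinearMap.ker (contractionBilin ρ v') := by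
    rw [heq, ker_contractionBilin]
  refine ⟨fun x hx ↦ mem_nullSpace_iff.1 (heq ▸ hx), ?_,
    LinearMap.IsRefl.liftQ₂ _ _ (isAlt_contractionBilin ρ v').isRefl hker.le, fun x y ↦ rfl, ?_, ?_⟩
  · have := (nullSpace ρ v).finrank_quotient_add_finrank
    rw [hρ.finrank_nullSpace hdim hv, hdim] at this
    omega
  · intro u
    induction u using Submodule.Quotient.induction_on with
    | H x => exact isAlt_contractionBilin ρ v' x
  · intro u hu
    induction u using Submodule.Quotient.induction_on with
    | H x =>
      rw [Submodule.Quotient.mk_eq_zero, heq, mem_nullSpace_iff]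
      exact fun z ↦ hu (Submodule.Quotient.mk z)
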